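/- Let S ⊆ ℝ² be compact with vol(S) > 0 and let v : ℝ² → ℝ^d be continuous on S. Suppose that for each n ∈ ℕ we are given a finite family S^n_1, …, S^n_{k_n} of pairwise disjoint Lebesgue-measurable subsets of ℝ² with ⋃_i S^n_i = S, tags s^n_i ∈ S^n_i, and that max_{i ≤ k_n} diam(S^n_i) → 0 as n → ∞. Let (Ω, P) be a probability space and suppose that for each n and each i ≤ k_n there is a sequence of random vectors (V^n_{i,m} : Ω → ℝ^d)_{m ∈ ℕ} such that V^n_{i,m} converges in probability to the constant v(s^n_i) as m → ∞. Then for every δ > 0 and α > 0 there exists N ∈ ℕ such that for every n ≥ N there exists M_n ∈ ℕ such that for all choices m₁, …, m_{k_n} ≥ M_n: P( ‖ ∑_{i=1}^{k_n} (vol(S^n_i)/vol(S)) • V^n_{i,m_i} − (1/vol(S)) ∫_S v(s) ds ‖ > δ ) ≤ α. -/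

import Mathlib

open MeasureTheory Metric Filter

/-- A tagged Riemann sum whose values are uniformly `ε`-close to `v` on each cell is
`μ.real S * ε`-close to the integral of `v` over the union `S` of the cells. -/
theorem norm_sum_measureReal_smul_sub_setIntegral_le {α E ι : Type*} [MeasurableSpace α]
    [NormedAddCommGroup E] [NormedSpace ℝ E] [CompleteSpace E] [Fintype ι] {μ : Measure α}
    {S : Set α} {A : ι → Set α} {v : α → E} {c : ι → E} {ε : ℝ}
    (hA : ∀ i, MeasurableSet (A i)) (hdisj : Pairwise (Function.onFun Disjoint A))
    (hunion : (⋃ i, A i) = S) (hS : μ S ≠ ⊤) (hv : IntegrableOn v S μ)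
    (hc : ∀ i, ∀ x ∈ A i, ‖c i - v x‖ ≤ ε) :
    ‖(∑ i, μ.real (A i) • c i) - ∫ x in S, v x ∂μ‖ ≤ μ.real S * ε := by
  subst hunion
  have hfin : ∀ i, μ (A i) ≠ ⊤ := fun i => measure_ne_top_of_subset (Set.subset_iUnion A i) hS
  have hvi : ∀ i, IntegrableOn v (A i) μ := fun i => hv.mono_set (Set.subset_iUnion A i)
  rw [integral_iUnion_fintype hA hdisj hvi, ← Finset.sum_sub_distrib,
    measureReal_iUnion_fintype hdisj hA hfin, Finset.sum_mul]
  refine norm_sum_le_of_le _ fun i _ => ?_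
  have hci : IntegrableOn (fun _ => c i) (A i) μ := integrableOn_const (hfin i)
  rw [← setIntegral_const, ← integral_sub hci (hvi i), mul_comm]
  exact norm_setIntegral_le_of_norm_le_const (hfin i).lt_top (hc i)

/-- If finitely many sequences of events have vanishing probability, then the union of
arbitrary members sufficiently far along the sequences has small probability. -/
theorem exists_forall_measure_iUnion_le {Ω ι : Type*} [MeasurableSpace Ω] [Fintype ι]
    {P : Measure Ω} {B : ι → ℕ → Set Ω}
    (hB : ∀ i, Tendsto (fun m => P (B i m)) atTop (nhds 0)) {a : ENNReal} (ha : a ≠ 0) :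
    ∃ M : ℕ, ∀ m : ι → ℕ, (∀ i, M ≤ m i) → P (⋃ i, B i (m i)) ≤ a := by
  have hpos : 0 < a / (Fintype.card ι : ENNReal) :=
    ENNReal.div_pos ha (ENNReal.natCast_ne_top _)
  obtain ⟨M, hM⟩ := eventually_atTop.1
    (eventually_all.2 fun i => (hB i).eventually_le_const hpos)
  refine ⟨M, fun m hm => ?_⟩
  calc P (⋃ i, B i (m i)) ≤ ∑ i, P (B i (m i)) := measure_iUnion_fintype_le _ _
    _ ≤ ∑ _i : ι, a / (Fintype.card ι : ENNReal) := Finset.sum_le_sum fun i _ => hM _ (hm i) i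
    _ ≤ a := by
      rw [Finset.sum_const, nsmul_eq_mul, Finset.card_univ]
      exact ENNReal.mul_div_le

/-- **Consistent estimation of the spatial τ-quantile causal partial effect
(Theorem 3 of the paper).**
`S ⊆ ℝ²` is compact with positive volume, `v : ℝ² → ℝ^d` is continuous on `S`.
For each `n` we have a partition of `S` into `k n` pairwise disjoint measurable
sets with tags, whose maximal diameter tends to `0`.  For each site, the random
vectors `V n i m` converge in probability (as `m → ∞`) to `v` evaluated at the
tag.  Then the volume-weighted aggregate estimator converges in probability to
the spatial average `(1/vol S) ∫_S v`. -/
theorem spatial_QPE_consistency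
    {d : ℕ} (S : Set (EuclideanSpace ℝ (Fin 2))) (hS : IsCompact S)
    (hSpos : 0 < volume S)
    (v : EuclideanSpace ℝ (Fin 2) → EuclideanSpace ℝ (Fin d))
    (hv : ContinuousOn v S)
    (k : ℕ → ℕ)
    (Si : ∀ n, Fin (k n) → Set (EuclideanSpace ℝ (Fin 2)))
    (s : ∀ n, Fin (k n) → EuclideanSpace ℝ (Fin 2))
    (hmeas : ∀ n i, MeasurableSet (Si n i))
    (hdisj : ∀ n, Pairwise (Function.onFun Disjoint (Si n)))
    (hunion : ∀ n, (⋃ i, Si n i) = S)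
    (htag : ∀ n i, s n i ∈ Si n i)
    (hdiam : ∀ ε > 0, ∃ N : ℕ, ∀ n ≥ N, ∀ i, diam (Si n i) ≤ ε)
    {Ω : Type*} [MeasurableSpace Ω] (P : Measure Ω) [IsProbabilityMeasure P]
    (V : ∀ n, Fin (k n) → ℕ → Ω → EuclideanSpace ℝ (Fin d))
    (hconv : ∀ n i, ∀ ε > 0,
      Tendsto (fun m => P {ω | ε < ‖V n i m ω - v (s n i)‖}) atTop (nhds 0)) :
    ∀ δ > 0, ∀ α > 0, ∃ N : ℕ, ∀ n ≥ N, ∃ M : ℕ,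
      ∀ m : Fin (k n) → ℕ, (∀ i, M ≤ m i) →
        P {ω | δ < ‖(∑ i, ((volume (Si n i)).toReal / (volume S).toReal) •
                      V n i (m i) ω) -
                    (1 / (volume S).toReal) • ∫ x in S, v x‖} ≤
          ENNReal.ofReal α := by
  intro δ hδ α hα
  have hSfin : volume S ≠ ⊤ := hS.measure_ne_top
  have hvol : 0 < (volume S).toReal := ENNReal.toReal_pos hSpos.ne' hSfin
  obtain ⟨η, hη, hvη⟩ := Metric.uniformContinuousOn_iff.1
    (hS.uniformContinuousOn_of_continuous hv) (δ / 2) (half_pos hδ)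
  obtain ⟨N, hN⟩ := hdiam (η / 2) (half_pos hη)
  refine ⟨N, fun n hn => ?_⟩
  have hsub : ∀ i, Si n i ⊆ S := fun i => hunion n ▸ Set.subset_iUnion (Si n) i
  have hcell : ∀ i, ∀ x ∈ Si n i, ‖v (s n i) - v x‖ ≤ δ / 2 := by
    intro i x hx
    rw [← dist_eq_norm]
    refine (hvη _ (hsub i (htag n i)) _ (hsub i hx) ?_).le
    have h := dist_le_diam_of_mem (hS.isBounded.subset (hsub i)) (htag n i) hx
    linarith [hN n hn i]
  have hriemann := norm_sum_measureReal_smul_sub_setIntegral_le (hmeas n) (hdisj n) (hunion n)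
    hSfin (hv.integrableOn_compact hS) hcell
  have hweights : ∑ i, (volume (Si n i)).toReal = (volume S).toReal := by
    have h := measureReal_iUnion_fintype (μ := volume) (hdisj n) (hmeas n)
      fun i => measure_ne_top_of_subset (hsub i) hSfin
    rw [hunion n] at h
    exact h.symm
  obtain ⟨M, hM⟩ := exists_forall_measure_iUnion_le
    (fun i => hconv n i (δ / 2) (half_pos hδ)) (ENNReal.ofReal_pos.2 hα).ne'
  refine ⟨M, fun m hm => (measure_mono fun ω hω => ?_).trans (hM m hm)⟩
  by_contra hbad
  simp only [Set.mem_iUnion, Set.mem_ofPred_eq, not_exists, not_lt] at hbad hω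
  have hnoise : ‖∑ i, (volume (Si n i)).toReal • (V n i (m i) ω - v (s n i))‖
      ≤ (volume S).toReal * (δ / 2) := by
    rw [← hweights, Finset.sum_mul]
    refine norm_sum_le_of_le _ fun i _ => ?_
    rw [norm_smul, Real.norm_of_nonneg ENNReal.toReal_nonneg]
    exact mul_le_mul_of_nonneg_left (hbad i) ENNReal.toReal_nonneg
  have hsplit : (∑ i, ((volume (Si n i)).toReal / (volume S).toReal) • V n i (m i) ω) -
        (1 / (volume S).toReal) • ∫ x in S, v x =
      (volume S).toReal⁻¹ • ((∑ i, (volume (Si n i)).toReal • (V n i (m i) ω - v (s n i))) +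
        ((∑ i, volume.real (Si n i) • v (s n i)) - ∫ x in S, v x)) := by
    simp only [Measure.real, smul_sub, Finset.sum_sub_distrib, sub_add_sub_cancel,
      Finset.smul_sum, smul_smul, div_eq_inv_mul, mul_one]
  refine hω.not_ge ?_
  rw [hsplit, norm_smul, norm_inv, Real.norm_of_nonneg hvol.le, inv_mul_le_iff₀ hvol]
  refine (norm_add_le_of_le hnoise hriemann).trans_eq ?_
  rw [Measure.real]
  ring
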